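/- The filled Julia set of z ↦ z² + i is connected: the set { z ∈ ℂ : the orbit of z under iteration of z ↦ z² + i is bounded } is a nonempty, compact, connected subset of ℂ. -/

import Mathlib

open Filter Topology

/-- The quadratic polynomial `p_c(z) = z² + c`. -/
def pc (c : ℂ) : ℂ → ℂ := fun z => z ^ 2 + c

/-- The filled Julia set of `p_c`: points with bounded forward orbit. -/
def Kc (c : ℂ) : Set ℂ :=
  {z : ℂ | Bornology.IsBounded (Set.range fun n : ℕ => (pc c)^[n] z)}

/-- A directed intersection of compact preconnected sets in a Hausdorff space is preconnected. -/
theorem isPreconnected_iInter_of_directed {X ι : Type*} [TopologicalSpace X] [T2Space X]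
    [Nonempty ι] {V : ι → Set X} (hV : Directed (· ⊇ ·) V) (hc : ∀ i, IsCompact (V i))
    (hp : ∀ i, IsPreconnected (V i)) : IsPreconnected (⋂ i, V i) := by
  have hS : IsCompact (⋂ i, V i) :=
    (hc (Classical.arbitrary ι)).of_isClosed_subset
      (isClosed_iInter fun i => (hc i).isClosed) (Set.iInter_subset _ _)
  refine isPreconnected_closed_iff.2 fun t t' ht ht' hsub hne hne' => ?_
  by_contra hemp
  have hdisj : Disjoint ((⋂ i, V i) ∩ t) ((⋂ i, V i) ∩ t') :=
    Set.disjoint_left.2 fun x hx hx' => hemp ⟨x, hx.1, hx.2, hx'.2⟩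
  obtain ⟨u, v, hu, hv, hsu, hsv, huv⟩ :=
    SeparatedNhds.of_isCompact_isCompact (hS.inter_right ht) (hS.inter_right ht') hdisj
  obtain ⟨i, hi⟩ := exists_subset_nhds_of_isCompact hV hc (U := u ∪ v) fun x hx =>
    (hu.union hv).mem_nhds <| (hsub hx).imp (fun h => hsu ⟨hx, h⟩) (fun h => hsv ⟨hx, h⟩)
  obtain ⟨x, hx⟩ := hne
  obtain ⟨y, hy⟩ := hne'
  obtain ⟨z, -, hz⟩ := hp i u v hu hv hi ⟨x, Set.mem_iInter.1 hx.1 i, hsu hx⟩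
    ⟨y, Set.mem_iInter.1 hy.1 i, hsv hy⟩
  exact Set.disjoint_left.1 huv hz.1 hz.2

theorem continuous_pc (c : ℂ) : Continuous (pc c) := by
  unfold pc
  fun_prop

theorem pc_neg (c z : ℂ) : pc c (-z) = pc c z := by
  simp [pc]

theorem eq_or_eq_neg_of_pc_eq {c z w : ℂ} (h : pc c z = pc c w) : z = w ∨ z = -w :=
  sq_eq_sq_iff_eq_or_eq_neg.1 (add_right_cancel h)

/-- If a connected set contains the critical value `c` of `p_c` and has compact preimage,
then this preimage is connected. -/
theorem isPreconnected_preimage_pc {c : ℂ} {D : Set ℂ} (hD : IsPreconnected D) (hc : c ∈ D)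
    (hE : IsCompact (pc c ⁻¹' D)) : IsPreconnected (pc c ⁻¹' D) := by
  have key : ∀ t t' : Set ℂ, IsClosed t → IsClosed t' → pc c ⁻¹' D ⊆ t ∪ t' → (0 : ℂ) ∈ t →
      (pc c ⁻¹' D ∩ t').Nonempty → (pc c ⁻¹' D ∩ (t ∩ t')).Nonempty := by
    rintro t t' ht ht' hsub h0 ⟨x, hx, hxt'⟩
    have hA : IsCompact (pc c ⁻¹' D ∩ (t ∩ -t)) := hE.inter_right (ht.inter ht.neg)
    have hB : IsCompact (pc c ⁻¹' D ∩ (t' ∪ -t')) := hE.inter_right (ht'.union ht'.neg)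
    obtain ⟨y, hyD, ⟨a, ⟨-, hat, hat'⟩, hay⟩, ⟨b, ⟨hbE, hbt⟩, hby⟩⟩ :=
      isPreconnected_closed_iff.1 hD _ _ (hA.image (continuous_pc c)).isClosed
        (hB.image (continuous_pc c)).isClosed
        (fun y hy => by
          obtain ⟨z, hz⟩ := IsAlgClosed.exists_pow_nat_eq (y - c) two_pos
          have hzy : pc c z = y := by simp [pc, hz]
          have hzE : z ∈ pc c ⁻¹' D := by rwa [Set.mem_preimage, hzy]
          have hnE : -z ∈ pc c ⁻¹' D := by rwa [Set.mem_preimage, pc_neg, hzy]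
          by_cases hz' : z ∈ t' ∪ -t'
          · exact Or.inr ⟨z, ⟨hzE, hz'⟩, hzy⟩
          · rw [Set.mem_union, not_or] at hz'
            exact Or.inl ⟨z, ⟨hzE, (hsub hzE).resolve_right hz'.1,
              (hsub hnE).resolve_right hz'.2⟩, hzy⟩)
        ⟨c, hc, 0, ⟨by simpa [pc] using hc, h0, by simpa using h0⟩, by simp [pc]⟩
        ⟨pc c x, hx, x, ⟨hx, Or.inl hxt'⟩, rfl⟩
    have hb : b ∈ t ∧ -b ∈ t := by
      rcases eq_or_eq_neg_of_pc_eq (hay.trans hby.symm) with rfl | rfl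
      · exact ⟨hat, hat'⟩
      · exact ⟨by simpa using hat', hat⟩
    rcases hbt with h | h
    · exact ⟨b, hbE, hb.1, h⟩
    · exact ⟨-b, by simpa [pc_neg] using hbE, hb.2, h⟩
  refine isPreconnected_closed_iff.2 fun t t' ht ht' hsub hne hne' => ?_
  rcases hsub (show (0 : ℂ) ∈ pc c ⁻¹' D by simpa [pc] using hc) with h0 | h0
  · exact key t t' ht ht' hsub h0 hne'
  · rw [Set.inter_comm t t']
    exact key t' t ht' ht (by rwa [Set.union_comm]) h0 hne

/-- Outside the disc of radius `2`, the distance to the disc grows at least by a factor `4`. -/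
theorem four_mul_norm_sub_two_le {c z : ℂ} (hc : ‖c‖ ≤ 2) (hz : 2 ≤ ‖z‖) :
    4 * (‖z‖ - 2) ≤ ‖pc c z‖ - 2 := by
  have h : ‖z‖ ^ 2 - ‖c‖ ≤ ‖pc c z‖ := by
    rw [← norm_pow]
    exact norm_sub_le_norm_add (z ^ 2) c
  nlinarith

theorem two_lt_norm_pc {c z : ℂ} (hc : ‖c‖ ≤ 2) (hz : 2 < ‖z‖) : 2 < ‖pc c z‖ := by
  linarith [four_mul_norm_sub_two_le hc hz.le]

theorem four_pow_mul_norm_sub_two_le {c z : ℂ} (hc : ‖c‖ ≤ 2) (hz : 2 < ‖z‖) (n : ℕ) :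
    2 < ‖(pc c)^[n] z‖ ∧ 4 ^ n * (‖z‖ - 2) ≤ ‖(pc c)^[n] z‖ - 2 := by
  induction n with
  | zero => simpa using hz
  | succ n ih =>
    rw [Function.iterate_succ_apply', pow_succ]
    have := four_mul_norm_sub_two_le hc ih.1.le
    exact ⟨two_lt_norm_pc hc ih.1, by linarith [ih.2]⟩

theorem Kc_eq_iInter {c : ℂ} (hc : ‖c‖ ≤ 2) :
    Kc c = ⋂ n : ℕ, (pc c)^[n] ⁻¹' Metric.closedBall 0 2 := by
  ext z
  simp only [Kc, Set.mem_ofPred_eq, Set.mem_iInter, Set.mem_preimage, mem_closedBall_zero_iff]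
  constructor
  · intro hb n
    by_contra! hn
    obtain ⟨C, hC⟩ := hb.exists_norm_le
    obtain ⟨m, hm⟩ := pow_unbounded_of_one_lt (C / (‖(pc c)^[n] z‖ - 2)) (by norm_num : (1 : ℝ) < 4)
    have h1 := (four_pow_mul_norm_sub_two_le hc hn m).2
    rw [div_lt_iff₀ (by linarith)] at hm
    rw [← Function.iterate_add_apply] at h1
    linarith [hC _ ⟨m + n, rfl⟩]
  · intro h
    refine isBounded_iff_forall_norm_le.2 ⟨2, ?_⟩
    rintro _ ⟨n, rfl⟩
    exact h n

theorem antitone_preimage_iterate_pc {c : ℂ} (hc : ‖c‖ ≤ 2) :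
    Antitone fun n : ℕ => (pc c)^[n] ⁻¹' Metric.closedBall 0 2 := by
  refine antitone_nat_of_succ_le fun n z hz => ?_
  simp only [Set.mem_preimage, mem_closedBall_zero_iff, Function.iterate_succ_apply'] at hz ⊢
  by_contra! h
  exact hz.not_gt (two_lt_norm_pc hc h)

theorem isCompact_preimage_iterate_pc {c : ℂ} (hc : ‖c‖ ≤ 2) (n : ℕ) :
    IsCompact ((pc c)^[n] ⁻¹' Metric.closedBall 0 2) :=
  (isCompact_closedBall (0 : ℂ) 2).of_isClosed_subset
    (Metric.isClosed_closedBall.preimage ((continuous_pc c).iterate n))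
    (antitone_preimage_iterate_pc hc n.zero_le)

theorem isPreconnected_preimage_iterate_pc {c : ℂ} (h : ∀ n, ‖(pc c)^[n] c‖ ≤ 2) (n : ℕ) :
    IsPreconnected ((pc c)^[n] ⁻¹' Metric.closedBall 0 2) := by
  induction n with
  | zero => exact (convex_closedBall (0 : ℂ) 2).isPreconnected
  | succ n ih =>
    have hE := isCompact_preimage_iterate_pc (h 0) (n + 1)
    rw [Function.iterate_succ, Set.preimage_comp] at hE ⊢
    exact isPreconnected_preimage_pc ih (by simpa using h n) hE

theorem isCompact_Kc {c : ℂ} (hc : ‖c‖ ≤ 2) : IsCompact (Kc c) := by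
  rw [Kc_eq_iInter hc]
  exact (isCompact_preimage_iterate_pc hc 0).of_isClosed_subset
    (isClosed_iInter fun n => (isCompact_preimage_iterate_pc hc n).isClosed)
    (Set.iInter_subset _ 0)

/-- If the critical orbit stays in the disc of radius `2`, the filled Julia set is connected. -/
theorem isConnected_Kc {c : ℂ} (h : ∀ n, ‖(pc c)^[n] c‖ ≤ 2) : IsConnected (Kc c) := by
  have hc : ‖c‖ ≤ 2 := h 0
  rw [Kc_eq_iInter hc]
  exact ⟨⟨c, Set.mem_iInter.2 fun n => by simpa using h n⟩,
    isPreconnected_iInter_of_directed (antitone_preimage_iterate_pc hc).directed_ge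
      (isCompact_preimage_iterate_pc hc) (isPreconnected_preimage_iterate_pc h)⟩

theorem iterate_pc_I (n : ℕ) :
    (pc Complex.I)^[n] Complex.I ∈ ({Complex.I, Complex.I - 1, -Complex.I} : Set ℂ) := by
  have h1 : pc Complex.I Complex.I = Complex.I - 1 := by
    simp only [pc, Complex.I_sq]
    ring
  have h2 : pc Complex.I (Complex.I - 1) = -Complex.I := by
    simp only [pc]
    linear_combination Complex.I_sq
  induction n with
  | zero => simp
  | succ n ih =>
    rw [Function.iterate_succ_apply']
    rcases ih with h | h | h <;> rw [h]
    · simp [h1]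
    · simp [h2]
    · simp [pc_neg, h1]

theorem norm_iterate_pc_I_le (n : ℕ) : ‖(pc Complex.I)^[n] Complex.I‖ ≤ 2 := by
  rcases iterate_pc_I n with h | h | h <;> rw [h]
  · simp
  · exact (norm_sub_le _ _).trans (by norm_num)
  · simp

/-- The filled Julia set of `z ↦ z² + i` is a nonempty, compact, connected subset
of `ℂ`. -/
theorem filledJulia_i_connected :
    (Kc Complex.I).Nonempty ∧ IsCompact (Kc Complex.I) ∧ IsConnected (Kc Complex.I) := by
  have h := isConnected_Kc norm_iterate_pc_I_le
  exact ⟨h.nonempty, isCompact_Kc (norm_iterate_pc_I_le 0), h⟩
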